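/- arXiv:2211.13288 — 6 statements merged into one kernel-verified Lean document; each statement's English description precedes it below -/
import Mathlib

section
/- Let f : V₁ → V₂ be a linear Poisson map between finite-dimensional Poisson vector spaces (V₁, λ₁) and (V₂, λ₂). Let W₂ be a linear subspace of V₂ and set W₁ = f⁻¹(W₂). Then f(W₁^{λ₁}) = W₂^{λ₂}, where Wᵢ^{λᵢ} = λᵢ^♯(Wᵢ°). -/
open Module Submodule

/-- Let `f : V₁ → V₂` be a linear Poisson map between finite-dimensional
Poisson vector spaces `(V₁, l1)` and `(V₂, l2)`.  Let `W₂` be a linear subspace of `V₂` and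
`W₁ = f⁻¹(W₂)`.  Then `f(W₁^{λ₁}) = W₂^{λ₂}`, where `Wᵢ^{λᵢ} = λᵢ^♯(Wᵢ°)`. -/
theorem linear_poisson_map_preimage_orthogonal
    (V₁ V₂ : Type*) [AddCommGroup V₁] [Module ℝ V₁] [AddCommGroup V₂] [Module ℝ V₂]
    [FiniteDimensional ℝ V₁] [FiniteDimensional ℝ V₂]
    (l1 : Dual ℝ V₁ →ₗ[ℝ] V₁) (l2 : Dual ℝ V₂ →ₗ[ℝ] V₂)
    (hl1 : ∀ α β : Dual ℝ V₁, β (l1 α) = - α (l1 β))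
    (hl2 : ∀ α β : Dual ℝ V₂, β (l2 α) = - α (l2 β))
    (f : V₁ →ₗ[ℝ] V₂) (hf : f ∘ₗ l1 ∘ₗ f.dualMap = l2)
    (W₂ : Submodule ℝ V₂) (W₁ : Submodule ℝ V₁) (hW₁ : W₁ = W₂.comap f) :
    (W₁.dualAnnihilator.map l1).map f = W₂.dualAnnihilator.map l2 := by
  subst hW₁
  have key : (W₂.comap f).dualAnnihilator = W₂.dualAnnihilator.map f.dualMap := by
    apply le_antisymm _ (dualAnnihilator_map_dualMap_le W₂ f)
    intro α hα
    have hk : LinearMap.ker (W₂.mkQ ∘ₗ f) = W₂.comap f := by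
      rw [LinearMap.ker_comp, Submodule.ker_mkQ]
    rw [← hk, ← LinearMap.range_dualMap_eq_dualAnnihilator_ker] at hα
    obtain ⟨γ, rfl⟩ := hα
    refine ⟨γ ∘ₗ W₂.mkQ, ?_, rfl⟩
    refine (Submodule.mem_dualAnnihilator _).2 fun w hw => ?_
    have : W₂.mkQ w = 0 := by simpa using hw
    rw [LinearMap.comp_apply, this, map_zero]
  rw [key, ← hf, Submodule.map_comp, Submodule.map_comp]
end

section
/- Let f : V₁ → V₂ be a linear Poisson map between finite-dimensional Poisson vector spaces (V₁, λ₁) and (V₂, λ₂). Let W₂ be a linear subspace of V₂ and set W₁ = f⁻¹(W₂). Then W₁ is coisotropic in (V₁, λ₁) if and only if W₂ is coisotropic in (V₂, λ₂). -/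
open Module Submodule

/-- Let `f : V₁ → V₂` be a linear Poisson map between finite-dimensional
Poisson vector spaces.  Let `W₂ ⊆ V₂` be a subspace and `W₁ = f⁻¹(W₂)`.  Then `W₁` is
coisotropic in `(V₁, λ₁)` if and only if `W₂` is coisotropic in `(V₂, λ₂)`. -/
theorem linear_poisson_map_preimage_coisotropic_iff
    (V₁ V₂ : Type*) [AddCommGroup V₁] [Module ℝ V₁] [AddCommGroup V₂] [Module ℝ V₂]
    [FiniteDimensional ℝ V₁] [FiniteDimensional ℝ V₂]
    (l1 : Dual ℝ V₁ →ₗ[ℝ] V₁) (l2 : Dual ℝ V₂ →ₗ[ℝ] V₂)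
    (hl1 : ∀ α β : Dual ℝ V₁, β (l1 α) = - α (l1 β))
    (hl2 : ∀ α β : Dual ℝ V₂, β (l2 α) = - α (l2 β))
    (f : V₁ →ₗ[ℝ] V₂) (hf : f ∘ₗ l1 ∘ₗ f.dualMap = l2)
    (W₂ : Submodule ℝ V₂) (W₁ : Submodule ℝ V₁) (hW₁ : W₁ = W₂.comap f) :
    W₁.dualAnnihilator.map l1 ≤ W₁ ↔ W₂.dualAnnihilator.map l2 ≤ W₂ := by
  have key : (W₂.comap f).dualAnnihilator = W₂.dualAnnihilator.map f.dualMap := by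
    have h1 : W₂.comap f = LinearMap.ker (W₂.mkQ ∘ₗ f) := by
      rw [LinearMap.ker_comp, Submodule.ker_mkQ]
    have h2 : W₂.dualAnnihilator = LinearMap.range W₂.mkQ.dualMap := by
      rw [LinearMap.range_dualMap_eq_dualAnnihilator_ker, Submodule.ker_mkQ]
    rw [h1, h2, ← LinearMap.range_dualMap_eq_dualAnnihilator_ker,
      ← LinearMap.dualMap_comp_dualMap, LinearMap.range_comp]
  subst hW₁
  rw [key, ← Submodule.map_le_iff_le_comap, ← hf, Submodule.map_comp, Submodule.map_comp]
end

section
/- Let (A, ω) be a finite-dimensional symplectic vector space, regarded as a Poisson vector space with λ_A^♯ = ω^♯, let (E, λ) be a finite-dimensional Poisson vector space, let μ : A → E be a linear Poisson map, and set γ = ω^♯ ∘ μ* : E* → A. Let 𝔣 be a linear subspace of E and let B = μ⁻¹(𝔣). Then the symplectic orthogonal of B satisfies B^ω = γ(𝔣°), where 𝔣° ⊆ E* is the annihilator of 𝔣. -/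
open Module Submodule

/-- Let `(A, ω)` be a finite-dimensional symplectic vector space (viewed as
a Poisson vector space with `λ_A^♯ = ω^♯`), `(E, λ)` a finite-dimensional Poisson vector
space, `μ : A → E` a linear Poisson map, and `γ = ω^♯ ∘ μ* : E* → A`.  Let `𝔣 ⊆ E` be a
linear subspace and `B = μ⁻¹(𝔣)`.  Then `B^ω = γ(𝔣°)`. -/
theorem moment_fibre_symplectic_orthogonal
    (A E : Type*) [AddCommGroup A] [Module ℝ A] [AddCommGroup E] [Module ℝ E]
    [FiniteDimensional ℝ A] [FiniteDimensional ℝ E]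
    (ω : A →ₗ[ℝ] A →ₗ[ℝ] ℝ) (halt : ∀ v, ω v v = 0)
    (ωsharp : Dual ℝ A →ₗ[ℝ] A)
    (hsharp₁ : ∀ v, ωsharp (ω v) = v) (hsharp₂ : ∀ α, ω (ωsharp α) = α)
    (lE : Dual ℝ E →ₗ[ℝ] E) (hlE : ∀ α β : Dual ℝ E, β (lE α) = - α (lE β))
    (μ : A →ₗ[ℝ] E) (hμ : μ ∘ₗ ωsharp ∘ₗ μ.dualMap = lE)
    (γ : Dual ℝ E →ₗ[ℝ] A) (hγ : γ = ωsharp ∘ₗ μ.dualMap)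
    (𝔣 : Submodule ℝ E) (B : Submodule ℝ A) (hB : B = 𝔣.comap μ) :
    B.dualAnnihilator.map ωsharp = 𝔣.dualAnnihilator.map γ := by
  subst hγ hB
  rw [Submodule.map_comp]
  congr 1
  refine le_antisymm ?_ (dualAnnihilator_map_dualMap_le 𝔣 μ)
  intro α hα
  have hk : LinearMap.ker (𝔣.mkQ ∘ₗ μ) = 𝔣.comap μ := by
    rw [LinearMap.ker_comp, Submodule.ker_mkQ]
  rw [← hk, ← LinearMap.range_dualMap_eq_dualAnnihilator_ker] at hα
  obtain ⟨β, rfl⟩ := hα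
  refine ⟨β ∘ₗ 𝔣.mkQ, ?_, rfl⟩
  refine (Submodule.mem_dualAnnihilator _).2 fun w hw => ?_
  rw [LinearMap.comp_apply, Submodule.mkQ_apply, (Submodule.Quotient.mk_eq_zero 𝔣).2 hw, map_zero]
end

section
/- Let (A, ω) be a finite-dimensional symplectic vector space, regarded as a Poisson vector space with λ_A^♯ = ω^♯, let (E, λ) be a finite-dimensional Poisson vector space, let μ : A → E be a linear Poisson map, and set γ = ω^♯ ∘ μ* : E* → A. Let 𝔣 be a linear subspace of E, let B = μ⁻¹(𝔣), and let K = B ∩ B^ω. Then K = μ⁻¹(𝔣) ∩ γ(𝔣°). Moreover, if γ is injective, then γ⁻¹(K) = 𝔥 where 𝔥 = (λ^♯)⁻¹(𝔣) ∩ 𝔣°, and γ restricts to a linear isomorphism from 𝔥 onto K. -/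
open Module Submodule

/-- In the setting of a linear Poisson map `μ : (A, ω) → (E, λ)` from a
finite-dimensional symplectic vector space, with `γ = ω^♯ ∘ μ*`, `𝔣 ⊆ E` a subspace,
`B = μ⁻¹(𝔣)` and `K = B ∩ B^ω`, one has `K = μ⁻¹(𝔣) ∩ γ(𝔣°)`.  Moreover, if `γ` is
injective, then `γ⁻¹(K) = 𝔥 := (λ^♯)⁻¹(𝔣) ∩ 𝔣°` and `γ` restricts to a linear
isomorphism from `𝔥` onto `K` (i.e. `γ(𝔥) = K`). -/
theorem moment_fibre_null_space
    (A E : Type*) [AddCommGroup A] [Module ℝ A] [AddCommGroup E] [Module ℝ E]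
    [FiniteDimensional ℝ A] [FiniteDimensional ℝ E]
    (ω : A →ₗ[ℝ] A →ₗ[ℝ] ℝ) (halt : ∀ v, ω v v = 0)
    (ωsharp : Dual ℝ A →ₗ[ℝ] A)
    (hsharp₁ : ∀ v, ωsharp (ω v) = v) (hsharp₂ : ∀ α, ω (ωsharp α) = α)
    (lE : Dual ℝ E →ₗ[ℝ] E) (hlE : ∀ α β : Dual ℝ E, β (lE α) = - α (lE β))
    (μ : A →ₗ[ℝ] E) (hμ : μ ∘ₗ ωsharp ∘ₗ μ.dualMap = lE)
    (γ : Dual ℝ E →ₗ[ℝ] A) (hγ : γ = ωsharp ∘ₗ μ.dualMap)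
    (𝔣 : Submodule ℝ E) (B : Submodule ℝ A) (hB : B = 𝔣.comap μ)
    (K : Submodule ℝ A) (hK : K = B ⊓ B.dualAnnihilator.map ωsharp)
    (𝔥 : Submodule ℝ (Dual ℝ E)) (h𝔥 : 𝔥 = 𝔣.comap lE ⊓ 𝔣.dualAnnihilator) :
    K = 𝔣.comap μ ⊓ 𝔣.dualAnnihilator.map γ
    ∧ (Function.Injective γ → (K.comap γ = 𝔥 ∧ 𝔥.map γ = K)) := by
  have key : (𝔣.comap μ).dualAnnihilator = 𝔣.dualAnnihilator.map μ.dualMap := by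
    have h1 : 𝔣.comap μ = LinearMap.ker (𝔣.mkQ ∘ₗ μ) := by
      rw [LinearMap.ker_comp, Submodule.ker_mkQ]
    have h2 : LinearMap.range (𝔣.mkQ).dualMap = 𝔣.dualAnnihilator := by
      rw [LinearMap.range_dualMap_eq_dualAnnihilator_ker, Submodule.ker_mkQ]
    rw [h1, ← LinearMap.range_dualMap_eq_dualAnnihilator_ker, ← LinearMap.dualMap_comp_dualMap,
      LinearMap.range_comp, h2]
  have hK' : K = 𝔣.comap μ ⊓ 𝔣.dualAnnihilator.map γ := by
    rw [hK, hB, key, hγ, Submodule.map_comp]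
  have hl : ∀ α, μ (γ α) = lE α := by
    intro α
    rw [← hμ, hγ]
    rfl
  refine ⟨hK', fun hinj => ?_⟩
  have hc : K.comap γ = 𝔥 := by
    rw [hK', h𝔥, Submodule.comap_inf, Submodule.comap_map_eq_of_injective hinj]
    congr 1
    ext α
    simp only [Submodule.mem_comap, hl]
  refine ⟨hc, ?_⟩
  rw [← hc, Submodule.map_comap_eq, inf_eq_right, hK']
  exact inf_le_right.trans LinearMap.map_le_range
end

section
/- Let (V, ω) be a finite-dimensional symplectic vector space, B a coisotropic subspace, and K = B^ω (so K ⊆ B). Let L be an isotropic subspace with V = B ⊕ L (internal direct sum), and define φ : V → K* by φ(v)(k) = ω(v, k). Then: (1) ker φ = B and φ restricts to a linear isomorphism from L onto K*; (2) the restriction of ω to K ⊕ L is nondegenerate, i.e. K ⊕ L is a symplectic subspace; (3) the subspace E = (K ⊕ L)^ω satisfies E ⊆ B, B = E ⊕ K, V = E ⊕ K ⊕ L, and the restriction of ω to E is nondegenerate. -/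
open Module Submodule

/-- The symplectic orthogonal `W^ω = {v : ω(v,w) = 0 for all w ∈ W}` of a subspace `W`
with respect to a bilinear form `ω`. -/
def sympOrth {V : Type*} [AddCommGroup V] [Module ℝ V]
    (ω : V →ₗ[ℝ] V →ₗ[ℝ] ℝ) (W : Submodule ℝ V) : Submodule ℝ V where
  carrier := {v | ∀ w ∈ W, ω v w = 0}
  add_mem' := by
    intro a b ha hb w hw
    simp [map_add, LinearMap.add_apply, ha w hw, hb w hw]
  zero_mem' := by
    intro w hw
    simp
  smul_mem' := by
    intro c a ha w hw
    simp [map_smul, LinearMap.smul_apply, ha w hw]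

/-- Let `(V, ω)` be a finite-dimensional symplectic vector space, `B` a
coisotropic subspace, `K = B^ω`, and `L` an isotropic subspace with `V = B ⊕ L`.  Define
`φ : V → K*` by `φ(v)(k) = ω(v,k)`.  Then (1) `ker φ = B` and `φ` restricts to a linear
isomorphism from `L` onto `K*`; (2) the restriction of `ω` to `K ⊕ L` is nondegenerate;
(3) `E = (K ⊕ L)^ω` satisfies `E ⊆ B`, `B = E ⊕ K`, `V = E ⊕ K ⊕ L`, and the restriction
of `ω` to `E` is nondegenerate. -/
theorem coisotropic_embedding_linear_decomposition
    (V : Type*) [AddCommGroup V] [Module ℝ V] [FiniteDimensional ℝ V]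
    (ω : V →ₗ[ℝ] V →ₗ[ℝ] ℝ) (halt : ∀ v, ω v v = 0)
    (hnd : ∀ v, (∀ w, ω v w = 0) → v = 0)
    (B : Submodule ℝ V) (hBco : sympOrth ω B ≤ B)
    (K : Submodule ℝ V) (hK : K = sympOrth ω B)
    (L : Submodule ℝ V) (hLiso : L ≤ sympOrth ω L) (hcompl : IsCompl B L)
    (φ : V →ₗ[ℝ] Dual ℝ ↥K) (hφ : ∀ (v : V) (k : ↥K), φ v k = ω v ↑k)
    (E : Submodule ℝ V) (hE : E = sympOrth ω (K ⊔ L)) :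
    (LinearMap.ker φ = B ∧ Function.Bijective (φ ∘ₗ L.subtype))
    ∧ (∀ v ∈ K ⊔ L, (∀ w ∈ K ⊔ L, ω v w = 0) → v = 0)
    ∧ (E ≤ B ∧ E ⊓ K = ⊥ ∧ E ⊔ K = B
        ∧ (E ⊔ K) ⊓ L = ⊥ ∧ E ⊔ K ⊔ L = ⊤
        ∧ ∀ v ∈ E, (∀ w ∈ E, ω v w = 0) → v = 0) := by
  have hsw : ∀ x y, ω x y = 0 → ω y x = 0 := by
    intro x y h
    have h1 := halt (x + y)
    simp only [map_add, LinearMap.add_apply, halt, h] at h1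
    linarith
  have hrefl : LinearMap.BilinForm.IsRefl ω := fun x y h => hsw x y h
  have hnd' : LinearMap.BilinForm.Nondegenerate ω :=
    ⟨fun v h => hnd v h, fun v h => hnd v fun w => hsw _ _ (h w)⟩
  have hort : ∀ W, sympOrth ω W = LinearMap.BilinForm.orthogonal ω W := by
    intro W
    ext v
    exact ⟨fun h w hw => hsw _ _ (h w hw), fun h w hw => hsw _ _ (h w hw)⟩
  have hKK : sympOrth ω K = B := by
    rw [hK, hort, hort, LinearMap.BilinForm.orthogonal_orthogonal hnd' hrefl]
  have hKB : K ≤ B := hK ▸ hBco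
  have hKo : ∀ k ∈ K, ∀ b ∈ B, ω k b = 0 := fun k hk => by rw [hK] at hk; exact hk
  have hdis : ∀ x, x ∈ B → x ∈ L → x = 0 := fun x h1 h2 =>
    (Submodule.disjoint_def.1 hcompl.disjoint) x h1 h2
  have hker : LinearMap.ker φ = B := by
    rw [← hKK]
    ext v
    rw [LinearMap.mem_ker]
    constructor
    · intro h k hk
      rw [← hφ v ⟨k, hk⟩, h]; rfl
    · intro h
      ext k
      rw [hφ]
      exact h k k.2
  have hinj : Function.Injective (φ ∘ₗ L.subtype) := by
    rw [← LinearMap.ker_eq_bot, LinearMap.ker_eq_bot']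
    intro l hl
    have : (l : V) ∈ LinearMap.ker φ := hl
    rw [hker] at this
    exact Subtype.ext (hdis _ this l.2)
  have hdim : finrank ℝ L = finrank ℝ (Dual ℝ K) := by
    rw [Subspace.dual_finrank_eq, hK, hort, LinearMap.BilinForm.finrank_orthogonal hnd']
    have := Submodule.finrank_add_eq_of_isCompl hcompl
    omega
  have h2 : ∀ v ∈ K ⊔ L, (∀ w ∈ K ⊔ L, ω v w = 0) → v = 0 := by
    intro v hv h
    obtain ⟨k, hk, l, hl, rfl⟩ := Submodule.mem_sup.1 hv
    have hl0 : l = 0 := by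
      refine hdis l ?_ hl
      rw [← hKK]
      intro k' hk'
      have := h k' (Submodule.mem_sup_left hk')
      rwa [map_add, LinearMap.add_apply, hKo k hk k' (hKB hk'), zero_add] at this
    subst hl0
    rw [add_zero] at h ⊢
    apply hnd
    intro w
    obtain ⟨b, hb, l, hl, rfl⟩ := Submodule.mem_sup.1
      (show w ∈ B ⊔ L by rw [hcompl.sup_eq_top]; trivial)
    rw [map_add, hKo k hk b hb, h l (Submodule.mem_sup_right hl), add_zero]
  have hC : IsCompl (K ⊔ L) E := by
    rw [hE, hort, LinearMap.BilinForm.isCompl_orthogonal_iff_disjoint hrefl, ← hort,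
      Submodule.disjoint_def]
    exact h2
  have hEB : E ≤ B := by
    rw [hE, ← hKK]
    exact fun v h k hk => h k (Submodule.mem_sup_left hk)
  have hEK : E ⊔ K = B := by
    apply le_antisymm (sup_le hEB hKB)
    intro b hb
    obtain ⟨x, hx, e, he, rfl⟩ := Submodule.mem_sup.1
      (show b ∈ (K ⊔ L) ⊔ E by rw [hC.sup_eq_top]; trivial)
    obtain ⟨k, hk, l, hl, rfl⟩ := Submodule.mem_sup.1 hx
    have hl0 : l = 0 := by
      refine hdis l ?_ hl
      have := B.sub_mem (B.sub_mem hb (hEB he)) (hKB hk)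
      convert this using 1
      abel
    subst hl0
    rw [add_zero, add_comm]
    exact Submodule.add_mem_sup he hk
  refine ⟨⟨hker, hinj, (LinearMap.injective_iff_surjective_of_finrank_eq_finrank hdim).1 hinj⟩,
    h2, hEB, ?_, hEK, ?_, ?_, ?_⟩
  · exact (hC.symm.disjoint.mono_right le_sup_left).eq_bot
  · rw [hEK]; exact hcompl.inf_eq_bot
  · rw [hEK]; exact hcompl.sup_eq_top
  · intro v hv h
    apply hnd
    intro w
    obtain ⟨x, hx, e, he, rfl⟩ := Submodule.mem_sup.1
      (show w ∈ (K ⊔ L) ⊔ E by rw [hC.sup_eq_top]; trivial)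
    rw [hE] at hv
    rw [map_add, h e he, hv x hx, add_zero]
end

section
/- Let φ : ℝ → ℝ be a smooth (C^∞) function with φ(0) = 0 and φ(x) ≠ 0 for all x ≠ 0. Then there exists a smooth function ψ : ℝ → ℝ such that x·φ'(x) = ψ(x)·φ(x) for all x ∈ ℝ if and only if φ is not flat at 0, i.e. there exists n ≥ 1 such that the n-th derivative of φ at 0 is nonzero. -/
theorem aux_hasDerivAt (h : ℝ → ℝ) (hh : ContDiff ℝ (⊤ : ℕ∞) h) (k : ℕ) (x₀ : ℝ) :
    HasDerivAt (fun x => ∫ t in (0:ℝ)..1, t ^ k * h (t * x))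
      (∫ t in (0:ℝ)..1, t ^ (k + 1) * deriv h (t * x₀)) x₀ := by
  have hc : Continuous h := hh.continuous
  have hd : Continuous (deriv h) := hh.continuous_deriv (by simp)
  have hcF : Continuous (fun p : ℝ × ℝ => p.2 ^ (k + 1) * deriv h (p.2 * p.1)) := by fun_prop
  obtain ⟨C, hC⟩ := ((isCompact_Icc (a := x₀ - 1) (b := x₀ + 1)).prod
    (isCompact_Icc (a := (0:ℝ)) (b := 1))).exists_bound_of_continuousOn hcF.continuousOn
  refine (intervalIntegral.hasDerivAt_integral_of_dominated_loc_of_deriv_le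
    (F := fun x t => t ^ k * h (t * x)) (F' := fun x t => t ^ (k + 1) * deriv h (t * x))
    (bound := fun _ => C) (s := Set.Icc (x₀ - 1) (x₀ + 1))
    (Icc_mem_nhds (by linarith) (by linarith)) ?_ ?_ ?_ ?_ ?_ ?_).2
  · refine Filter.Eventually.of_forall fun x => ?_
    exact (Continuous.aestronglyMeasurable (by fun_prop))
  · exact Continuous.intervalIntegrable (by fun_prop) _ _
  · exact (Continuous.aestronglyMeasurable (by fun_prop))
  · refine Filter.Eventually.of_forall fun t ht x hx => ?_
    rw [Set.uIoc_of_le zero_le_one] at ht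
    exact hC (x, t) ⟨hx, ht.1.le, ht.2⟩
  · exact intervalIntegrable_const
  · refine Filter.Eventually.of_forall fun t ht x hx => ?_
    have h1 : HasDerivAt h (deriv h (t * x)) (t * x) :=
      ((hh.differentiable (by simp)) _).hasDerivAt
    have h2 : HasDerivAt (fun x : ℝ => t * x) t x := by
      simpa using (hasDerivAt_id x).const_mul t
    have := (h1.comp x h2).const_mul (t ^ k)
    exact this.congr_deriv (by ring)

theorem smooth_deriv {h : ℝ → ℝ} (hh : ContDiff ℝ (⊤ : ℕ∞) h) :
    ContDiff ℝ (⊤ : ℕ∞) (deriv h) := (contDiff_infty_iff_deriv.1 hh).2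

theorem aux_smooth (n : ℕ) : ∀ (h : ℝ → ℝ) (_ : ContDiff ℝ (⊤ : ℕ∞) h) (k : ℕ),
    ContDiff ℝ n (fun x => ∫ t in (0:ℝ)..1, t ^ k * h (t * x)) := by
  induction n with
  | zero =>
    intro h hh k
    refine contDiff_zero.2 (continuous_iff_continuousAt.2 fun x =>
      (aux_hasDerivAt h hh k x).continuousAt)
  | succ n ih =>
    intro h hh k
    push_cast
    refine contDiff_succ_iff_deriv.2 ⟨fun x => (aux_hasDerivAt h hh k x).differentiableAt,
      by simp, ?_⟩
    have : deriv (fun x => ∫ t in (0:ℝ)..1, t ^ k * h (t * x)) =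
        fun x => ∫ t in (0:ℝ)..1, t ^ (k + 1) * deriv h (t * x) :=
      funext fun x => (aux_hasDerivAt h hh k x).deriv
    rw [this]
    exact ih _ (smooth_deriv hh) _

theorem hadamard_div (f : ℝ → ℝ) (hf : ContDiff ℝ (⊤ : ℕ∞) f) (h0 : f 0 = 0) :
    ∃ g : ℝ → ℝ, ContDiff ℝ (⊤ : ℕ∞) g ∧ ∀ x, f x = x * g x := by
  refine ⟨fun x => ∫ t in (0:ℝ)..1, t ^ 0 * deriv f (t * x),
    contDiff_infty.2 fun n => aux_smooth n _ (smooth_deriv hf) 0, fun x => ?_⟩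
  have hd : Continuous (deriv f) := (smooth_deriv hf).continuous
  have := intervalIntegral.integral_eq_sub_of_hasDerivAt (a := 0) (b := 1)
    (f := fun t => f (t * x)) (f' := fun t => x * deriv f (t * x)) (fun t _ => by
      have h1 : HasDerivAt f (deriv f (t * x)) (t * x) :=
        ((hf.differentiable (by simp)) _).hasDerivAt
      have h2 : HasDerivAt (fun t : ℝ => t * x) x t := by
        simpa using (hasDerivAt_id t).mul_const x
      rw [mul_comm]
      exact h1.comp t h2) (Continuous.intervalIntegrable (by fun_prop) _ _)
  simp [h0] at this
  simp [this]

theorem iter_mul (g : ℝ → ℝ) (hg : ContDiff ℝ (⊤ : ℕ∞) g) (k : ℕ) :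
    iteratedDeriv (k + 1) (fun x => x * g x) =
      fun x => x * iteratedDeriv (k + 1) g x + (k + 1) * iteratedDeriv k g x := by
  have hD : ∀ k x, HasDerivAt (iteratedDeriv k g) (iteratedDeriv (k + 1) g x) x := by
    intro k x
    rw [iteratedDeriv_succ]
    exact (hg.differentiable_iteratedDeriv k (by exact_mod_cast WithTop.coe_lt_top _) x).hasDerivAt
  induction k with
  | zero =>
    funext x
    have h := (hasDerivAt_id x).mul (hD 0 x)
    rw [iteratedDeriv_succ, iteratedDeriv_zero]
    simp only [iteratedDeriv_zero] at h ⊢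
    refine (HasDerivAt.deriv h).trans ?_
    simp; ring
  | succ k ih =>
    funext x
    rw [iteratedDeriv_succ, ih]
    have h := ((hasDerivAt_id x).mul (hD (k+1) x)).add ((hD k x).const_mul ((k:ℝ) + 1))
    refine (HasDerivAt.deriv h).trans ?_
    simp; ring

theorem factor (n : ℕ) : ∀ f : ℝ → ℝ, ContDiff ℝ (⊤ : ℕ∞) f → iteratedDeriv n f 0 ≠ 0 →
    ∃ (m : ℕ) (g : ℝ → ℝ), ContDiff ℝ (⊤ : ℕ∞) g ∧ g 0 ≠ 0 ∧ ∀ x, f x = x ^ m * g x := by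
  induction n with
  | zero => intro f hf h; exact ⟨0, f, hf, by simpa using h, by simp⟩
  | succ n ih =>
    intro f hf h
    by_cases h0 : f 0 = 0
    · obtain ⟨g, hg, hfg⟩ := hadamard_div f hf h0
      rw [show f = fun x => x * g x from funext hfg, iter_mul g hg] at h
      obtain ⟨m, g', hg', h0', hm⟩ := ih g hg (fun h' => h (by simp [h']))
      exact ⟨m + 1, g', hg', h0', fun x => by rw [hfg, hm]; ring⟩
    · exact ⟨0, f, hf, h0, by simp⟩

theorem flat_factor (n : ℕ) : ∀ f : ℝ → ℝ, ContDiff ℝ (⊤ : ℕ∞) f →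
    (∀ k, iteratedDeriv k f 0 = 0) →
    ∃ g : ℝ → ℝ, ContDiff ℝ (⊤ : ℕ∞) g ∧ g 0 = 0 ∧ ∀ x, f x = x ^ n * g x := by
  induction n with
  | zero => intro f hf h; exact ⟨f, hf, by simpa using h 0, by simp⟩
  | succ n ih =>
    intro f hf h
    obtain ⟨g, hg, hfg⟩ := hadamard_div f hf (by simpa using h 0)
    obtain ⟨g', hg', h0', hm⟩ := ih g hg (fun k => by
      have := h (k + 1)
      rw [show f = fun x => x * g x from funext hfg, iter_mul g hg] at this
      have hk : (k:ℝ) + 1 ≠ 0 := by positivity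
      simpa [hk] using this)
    exact ⟨g', hg', h0', fun x => by rw [hfg, hm]; ring⟩

theorem euler_pow (f g : ℝ → ℝ) (hg : ContDiff ℝ (⊤ : ℕ∞) g) (m : ℕ)
    (h : ∀ x, f x = x ^ m * g x) (x : ℝ) :
    x * deriv f x = x ^ m * (m * g x + x * deriv g x) := by
  have h1 : HasDerivAt g (deriv g x) x := ((hg.differentiable (by simp)) _).hasDerivAt
  have h2 := (hasDerivAt_pow m x).mul h1
  have h3 : deriv f x = m * x ^ (m - 1) * g x + x ^ m * deriv g x := by
    rw [show f = fun x => x ^ m * g x from funext h]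
    exact h2.deriv
  rw [h3]
  cases m with
  | zero => simp
  | succ m => simp only [Nat.add_sub_cancel]; ring

/-- Let `φ : ℝ → ℝ` be smooth with `φ(0) = 0` and `φ(x) ≠ 0` for
`x ≠ 0`.  Then there exists a smooth `ψ : ℝ → ℝ` with `x·φ'(x) = ψ(x)·φ(x)` for all `x`
if and only if `φ` is not flat at `0`, i.e. some `n`-th derivative of `φ` at `0` with
`n ≥ 1` is nonzero. -/
theorem log_divisibility_iff_not_flat
    (φ : ℝ → ℝ) (hφ : ContDiff ℝ (⊤ : ℕ∞) φ) (h0 : φ 0 = 0)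
    (hne : ∀ x : ℝ, x ≠ 0 → φ x ≠ 0) :
    (∃ ψ : ℝ → ℝ, ContDiff ℝ (⊤ : ℕ∞) ψ ∧ ∀ x, x * deriv φ x = ψ x * φ x)
      ↔ ∃ n : ℕ, 1 ≤ n ∧ iteratedDeriv n φ 0 ≠ 0 := by
  constructor
  · rintro ⟨ψ, hψ, hE⟩
    by_contra! hflat
    obtain ⟨C, hC⟩ := (isCompact_Icc (a := (0:ℝ)) (b := 1)).exists_bound_of_continuousOn
      hψ.continuous.continuousOn
    obtain ⟨N, hN⟩ := exists_nat_ge C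
    obtain ⟨g, hg, hg0, hfg⟩ := flat_factor N φ hφ (fun k => by
      rcases Nat.eq_zero_or_pos k with rfl | hk
      · simpa using h0
      · exact hflat k hk)
    have hgd : Differentiable ℝ g := hg.differentiable (by simp)
    have hanti : AntitoneOn (fun x => g x ^ 2) (Set.Icc 0 1) := by
      refine antitoneOn_of_deriv_nonpos (convex_Icc 0 1) (hg.continuous.pow 2).continuousOn
        (hgd.pow 2).differentiableOn ?_
      intro x hx
      rw [interior_Icc] at hx
      have hd : deriv (fun x => g x ^ 2) x = 2 * g x * deriv g x := by
        have := ((hgd x).hasDerivAt.fun_pow 2).deriv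
        simpa using this
      rw [hd]
      have h1 := euler_pow φ g hg N hfg x
      rw [hE, hfg] at h1
      have h2 : ψ x * g x = N * g x + x * deriv g x :=
        mul_left_cancel₀ (pow_ne_zero N hx.1.ne') (by linarith)
      have h3 : ψ x ≤ N := (le_abs_self _).trans ((hC x ⟨hx.1.le, hx.2.le⟩).trans hN)
      have h4 : x * (2 * g x * deriv g x) ≤ 0 := by
        have : x * (2 * g x * deriv g x) = 2 * (ψ x - N) * g x ^ 2 := by
          linear_combination (-2 * g x) * h2
        rw [this]
        nlinarith [sq_nonneg (g x)]
      by_contra! h5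
      exact absurd (mul_pos hx.1 h5) (not_lt.2 h4)
    have h := hanti (Set.left_mem_Icc.2 zero_le_one) (Set.right_mem_Icc.2 zero_le_one) zero_le_one
    have h1 : g 1 = 0 := by
      simp only [hg0] at h
      nlinarith [sq_nonneg (g 1)]
    exact hne 1 one_ne_zero (by rw [hfg, h1, mul_zero])
  · rintro ⟨n, -, hn⟩
    obtain ⟨m, g, hg, hg0, hfg⟩ := factor n φ hφ hn
    have hgne : ∀ x, g x ≠ 0 := by
      intro x hx
      by_cases h : x = 0
      · exact hg0 (h ▸ hx)
      · exact hne x h (by rw [hfg, hx, mul_zero])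
    refine ⟨fun x => m + x * deriv g x / g x,
      contDiff_const.add ((contDiff_id.mul (smooth_deriv hg)).div hg hgne), fun x => ?_⟩
    rw [euler_pow φ g hg m hfg x, hfg]
    have := hgne x
    field_simp
end
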